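/- Let H be the simple graph on the 31 vertices {r} ∪ {u_i, w_i, a_i, b_i, c_i, d_i : i ∈ ℤ/5ℤ} with the 50 edges r u_i, u_i w_i, u_i a_i, u_i d_i, w_i b_i, w_i c_i, a_i b_i, b_i c_i, c_i d_i, and d_i a_{i+1} for each i ∈ ℤ/5ℤ (indices modulo 5). (H is a Halin graph: the tree consists of the root r, its children u_i, the children w_i, a_i, d_i of u_i and the children b_i, c_i of w_i, and the 20 leaves a_0, b_0, c_0, d_0, a_1, …, d_4 are joined in a cycle in this order.) Then there is no assignment of a one-bend path P_x ⊆ ℝ² to each vertex x of H such that for all distinct vertices x, y: P_x ∩ P_y contains a horizontal or vertical line segment of nonzero length (i.e., there exist distinct points p, q with the closed segment [p,q] ⊆ P_x ∩ P_y) if and only if xy is an edge of H. In other words, H has no B_1-EPG representation. -/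

import Mathlib

/-- The 31 vertices of the Halin graph `H`: the root `r`, its children `u i`, the
children `w i`, `a i`, `d i` of `u i`, and the children `b i`, `c i` of `w i`. -/
inductive HVert where
  | r
  | u (i : Fin 5)
  | w (i : Fin 5)
  | a (i : Fin 5)
  | b (i : Fin 5)
  | c (i : Fin 5)
  | d (i : Fin 5)
deriving DecidableEq

/-- Half of the adjacency relation of `H` (the 50 edges, oriented). -/
def HAdjAux (x y : HVert) : Prop :=
  (∃ i, x = .r ∧ y = .u i) ∨ (∃ i, x = .u i ∧ y = .w i) ∨
  (∃ i, x = .u i ∧ y = .a i) ∨ (∃ i, x = .u i ∧ y = .d i) ∨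
  (∃ i, x = .w i ∧ y = .b i) ∨ (∃ i, x = .w i ∧ y = .c i) ∨
  (∃ i, x = .a i ∧ y = .b i) ∨ (∃ i, x = .b i ∧ y = .c i) ∨
  (∃ i, x = .c i ∧ y = .d i) ∨ (∃ i, x = .d i ∧ y = .a (i + 1))

/-- The adjacency relation of the Halin graph `H`. -/
def HAdj (x y : HVert) : Prop := HAdjAux x y ∨ HAdjAux y x

/-- A one-bend path in `ℝ²`: a horizontal segment and a vertical segment meeting at
the bend point `(xᵢ, yⱼ)` with `i, j ∈ {1, 2}`. -/
def IsOneBendPath (S : Set (ℝ × ℝ)) : Prop :=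
  ∃ x1 x2 y1 y2 xb yb : ℝ, x1 ≤ x2 ∧ y1 ≤ y2 ∧ (xb = x1 ∨ xb = x2) ∧
    (yb = y1 ∨ yb = y2) ∧
    S = {p | p.2 = yb ∧ x1 ≤ p.1 ∧ p.1 ≤ x2} ∪ {p | p.1 = xb ∧ y1 ≤ p.2 ∧ p.2 ≤ y2}

/-- Two subsets of `ℝ²` share a (horizontal or vertical) line segment of nonzero
length: there exist distinct points `p`, `q` with `[p, q] ⊆ A ∩ B`. -/
def SharesSeg (A B : Set (ℝ × ℝ)) : Prop :=
  ∃ p q : ℝ × ℝ, p ≠ q ∧ segment ℝ p q ⊆ A ∩ B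

/-- Coordinates of a one-bend path: the horizontal segment `[x1, x2] × {yb}` and the vertical
segment `{xb} × [y1, y2]`, meeting at the common end `(xb, yb)`. -/
structure BendPath where
  x1 : ℝ
  x2 : ℝ
  y1 : ℝ
  y2 : ℝ
  xb : ℝ
  yb : ℝ
  hx : x1 ≤ x2
  hy : y1 ≤ y2
  hxb : xb = x1 ∨ xb = x2
  hyb : yb = y1 ∨ yb = y2

namespace BendPath

/-- The point set of the horizontal segment. -/
def hSeg (P : BendPath) : Set (ℝ × ℝ) := {p | p.2 = P.yb ∧ P.x1 ≤ p.1 ∧ p.1 ≤ P.x2}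

/-- The point set of the vertical segment. -/
def vSeg (P : BendPath) : Set (ℝ × ℝ) := {p | p.1 = P.xb ∧ P.y1 ≤ p.2 ∧ p.2 ≤ P.y2}

/-- The reflection in the diagonal. -/
def swap (P : BendPath) : BendPath :=
  ⟨P.y1, P.y2, P.x1, P.x2, P.yb, P.xb, P.hy, P.hx, P.hyb, P.hxb⟩

/-- The vertical segments overlap in a segment of nonzero length. -/
def VMeet (P Q : BendPath) : Prop :=
  P.xb = Q.xb ∧ P.y1 < P.y2 ∧ P.y1 < Q.y2 ∧ Q.y1 < P.y2 ∧ Q.y1 < Q.y2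

/-- The horizontal segments overlap in a segment of nonzero length. -/
def HMeet (P Q : BendPath) : Prop := VMeet P.swap Q.swap

/-- The two paths share a segment of nonzero length. -/
def Meet (P Q : BendPath) : Prop := HMeet P Q ∨ VMeet P Q

theorem VMeet.symm {P Q : BendPath} (h : VMeet P Q) : VMeet Q P := by
  obtain ⟨h1, h2, h3, h4, h5⟩ := h
  exact ⟨h1.symm, h5, h4, h3, h2⟩

theorem Meet.symm {P Q : BendPath} (h : Meet P Q) : Meet Q P :=
  h.imp VMeet.symm VMeet.symm

theorem meet_swap {P Q : BendPath} : Meet P.swap Q.swap ↔ Meet P Q := or_comm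

/-- The vertical range of `m` separates those of `p` and `q`. -/
def Between (p m q : BendPath) : Prop :=
  (p.y2 ≤ m.y1 ∧ m.y2 ≤ q.y1) ∨ (q.y2 ≤ m.y1 ∧ m.y2 ≤ p.y1)

/-- Three pairwise disjoint intervals on a line are linearly ordered. -/
theorem between_trichotomy {u p q s : BendPath} (hp : VMeet u p) (hq : VMeet u q)
    (hs : VMeet u s) (hpq : ¬ Meet p q) (hps : ¬ Meet p s) (hqs : ¬ Meet q s) :
    Between p q s ∨ Between q p s ∨ Between p s q := by
  have h1 := fun h => hpq (Or.inr h)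
  have h2 := fun h => hps (Or.inr h)
  have h3 := fun h => hqs (Or.inr h)
  simp only [VMeet, Between] at *
  grind

/-- A path meeting the middle of three disjoint vertical intervals of `r` along its vertical
segment also meets `r`. -/
theorem meet_of_between {r p m q z : BendPath} (hp : VMeet r p) (hm : VMeet r m)
    (hq : VMeet r q) (hb : Between p m q) (hz : VMeet m z) : VMeet r z := by
  simp only [VMeet, Between] at *
  grind

/-- If a path avoiding `u` meets `m` and `p`, where `m` is the middle one of three disjoint
vertical intervals of `u`, then `m` and `p` have their horizontal segments on the same line. -/
theorem yb_eq_of_between {u p m q z : BendPath} (hp : VMeet u p) (hm : VMeet u m)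
    (hq : VMeet u q) (hb : Between p m q) (hzm : Meet m z) (hzp : Meet p z)
    (hzu : ¬ Meet u z) : p.yb = m.yb := by
  have hu : ¬ VMeet u z := fun h => hzu (Or.inr h)
  rcases hzm with hzm | hzm
  · rcases hzp with hzp | hzp
    · exact hzp.1.trans hzm.1.symm
    · have hmyb := m.hyb
      have hzyb := z.hyb
      simp only [HMeet, VMeet, Between, swap] at *
      grind
  · exact absurd (meet_of_between hp hm hq hb hzm) hu

/-- In the situation of `w`, `a`, `d` in this order on `u`, with `a` in the middle. -/
theorem not_between_side {u w a b c d : BendPath} (hw : VMeet u w) (ha : VMeet u a)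
    (hd : VMeet u d) (h : Between w a d) (hwb : Meet w b) (hwc : Meet w c) (hab : Meet a b)
    (hcd : Meet d c) (hub : ¬ Meet u b) (huc : ¬ Meet u c) : False := by
  have hy := yb_eq_of_between hw ha hd h hab hwb hub
  have hu : ¬ VMeet u c := fun h => huc (Or.inr h)
  have hayb := a.hyb
  have hcyb := c.hyb
  have hdyb := d.hyb
  have hwyb := w.hyb
  rcases hwc with hwc | hwc <;> rcases hcd with hcd | hcd <;>
  · simp only [HMeet, VMeet, Between, swap] at *
    grind

/-- The gadget below a vertex `u` of `H` has no representation in which all of `w`, `a`, `d`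
meet `u` along its vertical segment. -/
theorem gadget_false {u w a b c d : BendPath} (hw : VMeet u w) (ha : VMeet u a)
    (hd : VMeet u d) (hwb : Meet w b) (hwc : Meet w c) (hab : Meet a b) (hdc : Meet d c)
    (hub : ¬ Meet u b) (huc : ¬ Meet u c) (haw : ¬ Meet a w) (had : ¬ Meet a d)
    (hwd : ¬ Meet w d) : False := by
  rcases between_trichotomy ha hw hd haw had hwd with h | h | h
  · have h1 := yb_eq_of_between ha hw hd h hwb hab hub
    have h2 := yb_eq_of_between hd hw ha h.symm hwc hdc huc
    have hayb := a.hyb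
    have hwyb := w.hyb
    have hdyb := d.hyb
    simp only [VMeet, Between] at *
    grind
  · exact not_between_side hw ha hd h hwb hwc hab hdc hub huc
  · exact not_between_side hw hd ha h.symm hwc hwb hdc hab huc hub

/-- If `m` is the middle one of three disjoint vertical intervals of `r`, then every path
meeting `m` but not `r` meets `m` along its horizontal segment. -/
theorem hMeet_of_between {r p m q z : BendPath} (hp : VMeet r p) (hm : VMeet r m)
    (hq : VMeet r q) (hb : Between p m q) (hz : Meet m z) (hrz : ¬ Meet r z) : HMeet m z :=
  hz.resolve_right fun h => hrz (Or.inr (meet_of_between hp hm hq hb h))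

/-- A horizontal and a vertical segment share at most one point. -/
theorem subsingleton_hSeg_inter_vSeg (P Q : BendPath) : (P.hSeg ∩ Q.vSeg).Subsingleton := by
  rintro p ⟨hp, hp'⟩ q ⟨hq, hq'⟩
  exact Prod.ext (hp'.1.trans hq'.1.symm) (hp.1.trans hq.1.symm)

theorem vMeet_of_nontrivial {P Q : BendPath} (h : (P.vSeg ∩ Q.vSeg).Nontrivial) :
    VMeet P Q := by
  obtain ⟨p, ⟨⟨hp, hp1, hp2⟩, hp', hp3, hp4⟩, q, ⟨⟨hq, hq1, hq2⟩, -, hq3, hq4⟩, hne⟩ := h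
  have : p.2 ≠ q.2 := fun h => hne (Prod.ext (hp.trans hq.symm) h)
  refine ⟨hp.symm.trans hp', ?_⟩
  rcases lt_or_gt_of_ne this with h | h <;> refine ⟨?_, ?_, ?_, ?_⟩ <;> linarith

theorem hMeet_of_nontrivial {P Q : BendPath} (h : (P.hSeg ∩ Q.hSeg).Nontrivial) :
    HMeet P Q := by
  obtain ⟨p, ⟨hp, hp'⟩, q, ⟨hq, hq'⟩, hne⟩ := h
  exact vMeet_of_nontrivial
    ⟨p.swap, ⟨hp, hp'⟩, q.swap, ⟨hq, hq'⟩, fun h => hne (Prod.swap_injective h)⟩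

theorem infinite_segment {p q : ℝ × ℝ} (h : p ≠ q) : (segment ℝ p q).Infinite := by
  rw [segment_eq_image_lineMap]
  exact (Set.Icc_infinite zero_lt_one).image (AffineMap.lineMap_injective ℝ h).injOn

theorem sharesSeg_iff (P Q : BendPath) :
    SharesSeg (P.hSeg ∪ P.vSeg) (Q.hSeg ∪ Q.vSeg) ↔ Meet P Q := by
  constructor
  · rintro ⟨p, q, hne, hsub⟩
    have hinf := (infinite_segment hne).mono hsub
    rw [Set.union_inter_distrib_right, Set.inter_union_distrib_left,
      Set.inter_union_distrib_left] at hinf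
    rcases Set.infinite_union.1 hinf with h | h <;> rcases Set.infinite_union.1 h with h | h
    · exact Or.inl (hMeet_of_nontrivial h.nontrivial)
    · exact absurd (subsingleton_hSeg_inter_vSeg P Q).finite h
    · exact absurd (subsingleton_hSeg_inter_vSeg Q P).finite (by rwa [Set.inter_comm])
    · exact Or.inr (vMeet_of_nontrivial h.nontrivial)
  · rintro (⟨h1, h2, h3, h4, h5⟩ | ⟨h1, h2, h3, h4, h5⟩)
    · have hlt : max P.x1 Q.x1 < min P.x2 Q.x2 :=
        max_lt (lt_min h2 h3) (lt_min h4 h5)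
      refine ⟨(max P.x1 Q.x1, P.yb), (min P.x2 Q.x2, P.yb), fun h => hlt.ne (Prod.ext_iff.1 h).1,
        ?_⟩
      rw [← Prod.image_mk_segment_left, segment_eq_Icc hlt.le]
      rintro _ ⟨t, ⟨ht1, ht2⟩, rfl⟩
      rw [max_le_iff] at ht1
      rw [le_min_iff] at ht2
      exact ⟨Or.inl ⟨rfl, ht1.1, ht2.1⟩, Or.inl ⟨h1, ht1.2, ht2.2⟩⟩
    · have hlt : max P.y1 Q.y1 < min P.y2 Q.y2 :=
        max_lt (lt_min h2 h3) (lt_min h4 h5)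
      refine ⟨(P.xb, max P.y1 Q.y1), (P.xb, min P.y2 Q.y2), fun h => hlt.ne (Prod.ext_iff.1 h).2,
        ?_⟩
      rw [← Prod.image_mk_segment_right, segment_eq_Icc hlt.le]
      rintro _ ⟨t, ⟨ht1, ht2⟩, rfl⟩
      rw [max_le_iff] at ht1
      rw [le_min_iff] at ht2
      exact ⟨Or.inr ⟨rfl, ht1.1, ht2.1⟩, Or.inr ⟨h1, ht1.2, ht2.2⟩⟩

end BendPath

theorem IsOneBendPath.exists_bendPath {S : Set (ℝ × ℝ)} (h : IsOneBendPath S) :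
    ∃ P : BendPath, S = P.hSeg ∪ P.vSeg := by
  obtain ⟨x1, x2, y1, y2, xb, yb, hx, hy, hxb, hyb, rfl⟩ := h
  exact ⟨⟨x1, x2, y1, y2, xb, yb, hx, hy, hxb, hyb⟩, rfl⟩

open BendPath in
/-- No representation of `H` has three of the `u i` meeting `r` along its vertical segment. -/
theorem not_three_vMeet {Q : HVert → BendPath}
    (hQ : ∀ x y : HVert, x ≠ y → (Meet (Q x) (Q y) ↔ HAdj x y)) {i j k : Fin 5}
    (hij : i ≠ j) (hik : i ≠ k) (hjk : j ≠ k) (hi : VMeet (Q .r) (Q (.u i)))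
    (hj : VMeet (Q .r) (Q (.u j))) (hk : VMeet (Q .r) (Q (.u k))) : False := by
  have hu : ∀ {i j : Fin 5}, i ≠ j → ¬ Meet (Q (.u i)) (Q (.u j)) := by
    intro i j h
    rw [hQ _ _ (by simpa using h)]
    simp [HAdj, HAdjAux]
  have middle : ∀ {i j k : Fin 5}, VMeet (Q .r) (Q (.u i)) → VMeet (Q .r) (Q (.u j)) →
      VMeet (Q .r) (Q (.u k)) → ¬ Between (Q (.u i)) (Q (.u j)) (Q (.u k)) := by
    intro i j k hi hj hk hb
    have key : ∀ z : HVert, z ≠ .r → z ≠ .u j → HAdj (.u j) z → ¬ HAdj .r z →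
        HMeet (Q (.u j)) (Q z) := fun z h1 h2 h3 h4 =>
      hMeet_of_between hi hj hk hb ((hQ _ _ h2.symm).2 h3) (by rwa [hQ _ _ h1.symm])
    refine gadget_false (u := (Q (.u j)).swap) (w := (Q (.w j)).swap) (a := (Q (.a j)).swap)
      (b := (Q (.b j)).swap) (c := (Q (.c j)).swap) (d := (Q (.d j)).swap)
      (key _ ?_ ?_ ?_ ?_) (key _ ?_ ?_ ?_ ?_) (key _ ?_ ?_ ?_ ?_) ?_ ?_ ?_ ?_ ?_ ?_ ?_ ?_ ?_
    all_goals try rw [meet_swap, hQ _ _ (by simp)]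
    all_goals simp [HAdj, HAdjAux]
  rcases between_trichotomy hi hj hk (hu hij) (hu hik) (hu hjk) with h | h | h
  · exact middle hi hj hk h
  · exact middle hj hi hk h
  · exact middle hi hk hj h

/-- Among five elements with a two-valued property, three share the value. -/
theorem exists_three_of_five {p q : Fin 5 → Prop} (h : ∀ i, p i ∨ q i) :
    ∃ i j k : Fin 5, i ≠ j ∧ i ≠ k ∧ j ≠ k ∧ ((p i ∧ p j ∧ p k) ∨ (q i ∧ q j ∧ q k)) := by
  classical
  have key : ∀ f : Fin 5 → Bool, ∃ i j k : Fin 5, i ≠ j ∧ i ≠ k ∧ j ≠ k ∧ f i = f j ∧ f i = f k := by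
    decide
  obtain ⟨i, j, k, hij, hik, hjk, h1, h2⟩ := key fun i => decide (p i)
  refine ⟨i, j, k, hij, hik, hjk, ?_⟩
  have hi := h i
  have hj := h j
  have hk := h k
  simp only [decide_eq_decide] at h1 h2
  tauto

/-- the Halin graph `H` has no B₁-EPG representation. -/
theorem stmt18 :
    ¬ ∃ P : HVert → Set (ℝ × ℝ),
      (∀ x, IsOneBendPath (P x)) ∧
      ∀ x y : HVert, x ≠ y → (SharesSeg (P x) (P y) ↔ HAdj x y) := by
  rintro ⟨P, hP, hadj⟩
  choose Q hQ using fun x => (hP x).exists_bendPath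
  have hmeet : ∀ x y : HVert, x ≠ y → (BendPath.Meet (Q x) (Q y) ↔ HAdj x y) := fun x y hxy => by
    rw [← hadj x y hxy, hQ x, hQ y, BendPath.sharesSeg_iff]
  have hr : ∀ i, BendPath.Meet (Q .r) (Q (.u i)) := fun i =>
    (hmeet _ _ (by simp)).2 (Or.inl (Or.inl ⟨i, rfl, rfl⟩))
  obtain ⟨i, j, k, hij, hik, hjk, ⟨hi, hj, hk⟩ | ⟨hi, hj, hk⟩⟩ := exists_three_of_five hr
  · exact not_three_vMeet (Q := fun x => (Q x).swap)
      (fun x y hxy => BendPath.meet_swap.trans (hmeet x y hxy)) hij hik hjk hi hj hk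
  · exact not_three_vMeet hmeet hij hik hjk hi hj hk
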